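/- If z is a language satisfying z = a·z + z·b + s, then for all i, j ≥ 0, aⁱ·s·bʲ ⊆ z. -/

import Mathlib

theorem stmt_8 {α : Type*} (a b s z : Language α)
    (hz : z = a * z + z * b + s) :
    ∀ i j : ℕ, a ^ i * s * b ^ j ≤ z := by
  have h : a * z + z * b + s ≤ z := hz.symm.le
  rw [add_le_iff, add_le_iff] at h
  obtain ⟨⟨ha, hb⟩, hs⟩ := h
  intro i j
  induction j with
  | zero =>
    rw [pow_zero, mul_one]
    induction i with
    | zero => rwa [pow_zero, one_mul]
    | succ i ih =>
      rw [pow_succ', mul_assoc]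
      exact (mul_le_mul_right ih a).trans ha
  | succ j ih =>
    rw [pow_succ, ← mul_assoc]
    exact (mul_le_mul_left ih b).trans hb
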